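/- arXiv:1606.06664 — 3 statements merged into one kernel-verified Lean document; each statement's English description precedes it below -/
import Mathlib

section
/- Consider an instance of Inequity Aversion Pricing with price set P = {1, 2} and val(v) ∈ {1, 2} for all v ∈ V, and let G' be the associated bipartite graph. If M is any matching in G' (a set of pairwise vertex-disjoint edges of E'), then every feasible price vector p satisfies R(p) ≤ MAX − |M|. In particular, OPT ≤ MAX − ν(G'), where ν(G') is the maximum matching size of G'. -/
/-- A price vector assigns to each vertex either a price in `P` or `none` (a discontinuity).
It is feasible if all assigned prices lie in `P` and, for every edge `(u,v)` with both
endpoints priced, the price at `u` exceeds the price at `v` by at most `A u v`. -/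
def Feasible {V : Type*} (G : SimpleGraph V) (A : V → V → ℕ) (P : Finset ℕ)
    (p : V → Option ℕ) : Prop :=
  (∀ v a, p v = some a → a ∈ P) ∧
  ∀ u v, G.Adj u v → ∀ a b, p u = some a → p v = some b → a ≤ b + A u v

/-- The revenue of a price vector: a priced vertex `v` contributes its price `a`
if `a ≤ val v`, and `0` otherwise; a discontinuity contributes `0`. -/
def revenue {V : Type*} [Fintype V] (val : V → ℕ) (p : V → Option ℕ) : ℕ :=
  ∑ v, (p v).elim 0 (fun a => if a ≤ val v then a else 0)

/-- in a `{1,2}`-instance, for any matching `M` in the bipartite graph `G'`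
(pairwise vertex-disjoint edges `(u,v) ∈ E` with `val u = 2`, `val v = 1`, `α(u,v) = 0`),
every feasible price vector has revenue at most `MAX − |M|`. -/
theorem stmt_5 {V : Type*} [Fintype V] [DecidableEq V]
    (G : SimpleGraph V) (A : V → V → ℕ) (val : V → ℕ)
    (hval : ∀ v, val v = 1 ∨ val v = 2)
    (M : Finset (V × V))
    (hM : ∀ e ∈ M, G.Adj e.1 e.2 ∧ val e.1 = 2 ∧ val e.2 = 1 ∧ A e.1 e.2 = 0)
    (hdisj : ∀ e ∈ M, ∀ f ∈ M, e ≠ f →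
      e.1 ≠ f.1 ∧ e.1 ≠ f.2 ∧ e.2 ≠ f.1 ∧ e.2 ≠ f.2)
    (p : V → Option ℕ) (hp : Feasible G A {1, 2} p) :
    revenue val p + M.card ≤ ∑ v, val v := by
  unfold revenue
  set r : V → ℕ := fun v => (p v).elim 0 (fun a => if a ≤ val v then a else 0) with hr
  have hle : ∀ v, r v ≤ val v := by
    intro v
    simp only [hr]
    cases p v with
    | none => simp
    | some a => simp only [Option.elim_some]; split_ifs <;> omega
  have hloss : ∀ e ∈ M, r e.1 < val e.1 ∨ r e.2 < val e.2 := by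
    intro e he
    obtain ⟨hadj, h1, h2, hA⟩ := hM e he
    have hfeas := hp.2 e.1 e.2 hadj
    have hpos := hp.1 e.2
    simp only [hr]
    cases hu : p e.1 with
    | none => simp [h1]
    | some a =>
      cases hv : p e.2 with
      | none => simp [h2]
      | some b =>
        have hab := hfeas a b hu hv
        have hb := hpos b hv
        simp only [Finset.mem_insert, Finset.mem_singleton] at hb
        simp only [Option.elim_some]
        split_ifs <;> omega
  let w : V × V → V := fun e => if r e.1 < val e.1 then e.1 else e.2
  have hw : ∀ e ∈ M, r (w e) < val (w e) := by
    intro e he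
    have := hloss e he
    simp only [w]
    split_ifs with h
    · exact h
    · exact this.resolve_left h
  have hinj : Set.InjOn w M := by
    intro e he f hf hef
    by_contra hne
    obtain ⟨h11, h12, h21, h22⟩ := hdisj e he f hf hne
    simp only [w] at hef
    split_ifs at hef <;> contradiction
  have hcard : M.card = ∑ v, if v ∈ M.image w then 1 else 0 := by
    rw [← Finset.card_image_of_injOn hinj, Finset.sum_boole, Finset.filter_univ_mem, Nat.cast_id]
  rw [hcard, ← Finset.sum_add_distrib]
  refine Finset.sum_le_sum fun v _ => ?_
  split_ifs with hv
  · obtain ⟨e, he, rfl⟩ := Finset.mem_image.mp hv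
    exact hw e he
  · exact hle v
end

section
/- Let I be an instance of Inequity Aversion Pricing with price set P = {1, …, k} and values val(v) ∈ P, let j = max_{v∈V} val(v) with j ≥ 2, and let V_j = {v ∈ V : val(v) = j}. Let I* be the instance obtained from I by keeping the same graph and edge bounds α but replacing the values by val*(v) = min{val(v), j − 1}. Then OPT(I*) ≥ OPT(I) − |V_j|, where OPT(I) and OPT(I*) are the maximum revenues of feasible price vectors for I and I* respectively. -/
/-- truncating the top value `j = max val ≥ 2` down to `j - 1` loses at most
`|V_j|` revenue: for every feasible price vector `p` of the original instance `I` there is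
a feasible price vector `q` of the truncated instance `I*` with
`R_{I*}(q) + |V_j| ≥ R_I(p)`, i.e. `OPT(I*) ≥ OPT(I) − |V_j|`. -/
theorem stmt_9 {V : Type*} [Fintype V] [DecidableEq V]
    (G : SimpleGraph V) (A : V → V → ℕ) (k : ℕ)
    (val : V → ℕ) (hval : ∀ v, val v ∈ Finset.Icc 1 k)
    (j : ℕ) (hj : j = Finset.univ.sup val) (hj2 : 2 ≤ j)
    (p : V → Option ℕ) (hp : Feasible G A (Finset.Icc 1 k) p) :
    ∃ q, Feasible G A (Finset.Icc 1 k) q ∧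
      revenue val p ≤
        revenue (fun v => min (val v) (j - 1)) q +
          (Finset.univ.filter fun v => val v = j).card := by
  refine ⟨fun v => (p v).map (min · (j - 1)), ⟨?_, ?_⟩, ?_⟩
  · intro v a hv
    obtain ⟨b, hb, rfl⟩ := Option.map_eq_some_iff.mp hv
    have := hp.1 v b hb
    rw [Finset.mem_Icc] at this ⊢
    omega
  · intro u v huv a b hu hv
    obtain ⟨a, ha, rfl⟩ := Option.map_eq_some_iff.mp hu
    obtain ⟨b, hb, rfl⟩ := Option.map_eq_some_iff.mp hv
    have := hp.2 u v huv a b ha hb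
    omega
  · rw [Finset.card_filter]
    unfold revenue
    rw [← Finset.sum_add_distrib]
    refine Finset.sum_le_sum fun v _ => ?_
    have hv : val v ≤ j := hj ▸ Finset.le_sup (Finset.mem_univ v)
    beta_reduce
    rcases p v with _ | a
    · simp
    · simp only [Option.map_some, Option.elim_some]
      split_ifs <;> omega
end

section
/- Let I be a Multi-Demand Inequity Aversion Pricing instance: a finite simple graph G = (V, E), edge bounds α(u,v), a price set P of positive integers, values val(v) ∈ P, and positive integer demands s_v. Let I' be the unit-demand instance obtained by replacing each vertex v by a clique of s_v copies of v with α = 0 on all edges inside each clique, each copy inheriting value val(v), and, for each edge (u,v) ∈ E, joining every copy of u to every copy of v by an edge with the same bounds α(u,v) and α(v,u). Then the maximum revenue of a feasible price vector for I (where a price a ≤ val(v) at vertex v earns s_v·a) equals the maximum revenue of a feasible price vector for I' (where a price a ≤ val of a copy earns a). -/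
/-- the multi-demand instance `I` (demands `s v ≥ 1`) and its unit-demand
blow-up `I'` (each vertex `v` replaced by a clique of `s v` copies with `α = 0` inside,
copies inheriting `val v` and the cross edges inheriting the bounds of `(u,v)`) have equal
optimal revenue: each feasible vector of either instance is dominated by a feasible vector
of the other. -/
theorem stmt_15 {V : Type*} [Fintype V] [DecidableEq V]
    (G : SimpleGraph V) (A : V → V → ℕ) (P : Finset ℕ)
    (val : V → ℕ) (hval : ∀ v, val v ∈ P)
    (s : V → ℕ) (hs : ∀ v, 0 < s v) :
    (∀ p : V → Option ℕ, Feasible G A P p →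
      ∃ p' : (Σ v : V, Fin (s v)) → Option ℕ,
        Feasible
          (SimpleGraph.fromRel fun a b : Σ v : V, Fin (s v) => a.1 = b.1 ∨ G.Adj a.1 b.1)
          (fun a b => if a.1 = b.1 then 0 else A a.1 b.1) P p' ∧
        (∑ v, (p v).elim 0 fun a => if a ≤ val v then s v * a else 0) ≤
          revenue (fun a => val a.1) p') ∧
    (∀ p' : (Σ v : V, Fin (s v)) → Option ℕ,
      Feasible
        (SimpleGraph.fromRel fun a b : Σ v : V, Fin (s v) => a.1 = b.1 ∨ G.Adj a.1 b.1)
        (fun a b => if a.1 = b.1 then 0 else A a.1 b.1) P p' →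
      ∃ p : V → Option ℕ, Feasible G A P p ∧
        revenue (fun a => val a.1) p' ≤
          ∑ v, (p v).elim 0 fun a => if a ≤ val v then s v * a else 0) := by
  refine ⟨fun p hp => ?_, fun p' hp' => ?_⟩
  · refine ⟨fun x => p x.1, ⟨fun x => hp.1 x.1, ?_⟩, ?_⟩
    · intro x y hxy a b ha hb
      rw [SimpleGraph.fromRel_adj] at hxy
      by_cases h : x.1 = y.1
      · simp only [h] at ha
        simp_all
      · have hadj : G.Adj x.1 y.1 := by
          rcases hxy.2 with (h' | h') | (h' | h')
          exacts [absurd h' h, h', absurd h'.symm h, h'.symm]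
        simpa [h] using hp.2 _ _ hadj a b ha hb
    · rw [revenue, Fintype.sum_sigma]
      refine Finset.sum_le_sum fun v _ => ?_
      change _ ≤ ∑ _i : Fin (s v), (p v).elim 0 (fun a => if a ≤ val v then a else 0)
      cases h : p v <;> simp
  · have key : ∀ v, ∃ o : Option ℕ, (∀ a, o = some a → ∃ i, p' ⟨v, i⟩ = some a) ∧
        ∀ i a, p' ⟨v, i⟩ = some a → o = some a := by
      intro v
      by_cases h : ∃ i a, p' ⟨v, i⟩ = some a
      · obtain ⟨i, a, hi⟩ := h
        refine ⟨some a, fun b hb => ⟨i, hi.trans hb⟩, fun j b hj => ?_⟩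
        by_cases hij : i = j
        · subst hij
          exact hi.symm.trans hj
        · have hne : (⟨v, i⟩ : Σ v, Fin (s v)) ≠ ⟨v, j⟩ := by simpa using hij
          have h₁ := hp'.2 ⟨v, i⟩ ⟨v, j⟩ ⟨hne, Or.inl (Or.inl rfl)⟩ a b hi hj
          have h₂ := hp'.2 ⟨v, j⟩ ⟨v, i⟩ ⟨hne.symm, Or.inl (Or.inl rfl)⟩ b a hj hi
          simp only [if_true, add_zero] at h₁ h₂
          rw [le_antisymm h₁ h₂]
      · exact ⟨none, by simp, fun i a hi => absurd ⟨i, a, hi⟩ h⟩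
    choose p hex hall using key
    refine ⟨p, ⟨?_, ?_⟩, ?_⟩
    · intro v a ha
      obtain ⟨i, hi⟩ := hex v a ha
      exact hp'.1 _ _ hi
    · intro u v huv a b ha hb
      obtain ⟨i, hi⟩ := hex u a ha
      obtain ⟨j, hj⟩ := hex v b hb
      have hne : (⟨u, i⟩ : Σ v, Fin (s v)) ≠ ⟨v, j⟩ := fun h => huv.ne (congrArg Sigma.fst h)
      simpa [huv.ne] using hp'.2 ⟨u, i⟩ ⟨v, j⟩ ⟨hne, Or.inl (Or.inr huv)⟩ a b hi hj
    · rw [revenue, Fintype.sum_sigma]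
      refine Finset.sum_le_sum fun v _ => ?_
      calc ∑ i : Fin (s v), (p' ⟨v, i⟩).elim 0 (fun a => if a ≤ val v then a else 0)
          ≤ ∑ _i : Fin (s v), (p v).elim 0 (fun a => if a ≤ val v then a else 0) := by
            refine Finset.sum_le_sum fun i _ => ?_
            cases h : p' ⟨v, i⟩ with
            | none => simp
            | some a => rw [hall v i a h]
        _ ≤ _ := by cases h : p v <;> simp
end
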